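/- arXiv:1406.6745 — 2 statements merged into one kernel-verified Lean document; each statement's English description precedes it below -/
import Mathlib

section
/- The number of pairs of integers (A,B) with |A| ≤ X, B² ≤ X, A² − 4B ≠ 0, and such that for every prime p, p⁴ ∣ B implies p² ∤ A, is asymptotic to 4X^{3/2}/ζ(6) as X → ∞. -/
open Filter

/-- The set `𝓔(X)` of pairs `(A,B)` with `|A| ≤ X`, `B² ≤ X`, `A² - 4B ≠ 0`, and such that
for every prime `p`, `p⁴ ∣ B` implies `p² ∤ A`. -/
def curveFamily (X : ℝ) : Set (ℤ × ℤ) :=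
  {AB : ℤ × ℤ | (|AB.1| : ℝ) ≤ X ∧ ((AB.2 : ℝ)) ^ 2 ≤ X ∧ AB.1 ^ 2 - 4 * AB.2 ≠ 0 ∧
    ∀ p : ℕ, p.Prime → (p : ℤ) ^ 4 ∣ AB.2 → ¬ (p : ℤ) ^ 2 ∣ AB.1}

/-- `ζ(6)`, written as the sum of the series `∑ n ≥ 1, n⁻⁶`. -/
noncomputable def zetaSix : ℝ := ∑' n : ℕ, 1 / ((n : ℝ) + 1) ^ 6


/-- primitivity predicate -/
def PrimPair (A B : ℤ) : Prop :=
  ∀ p : ℕ, p.Prime → (p : ℤ) ^ 4 ∣ B → ¬ (p : ℤ) ^ 2 ∣ A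

lemma zetaSix_mul_moebius :
    zetaSix * ∑' d : ℕ, (ArithmeticFunction.moebius d : ℝ) / (d : ℝ) ^ 6 = 1 := by
  have h6 : (1 : ℝ) < (6 : ℂ).re := by norm_num
  have h := LSeries_one_mul_Lseries_moebius h6
  have h1 : LSeries 1 (6 : ℂ) = ((zetaSix : ℝ) : ℂ) := by
    rw [LSeries_one_eq_riemannZeta h6, zeta_eq_tsum_one_div_nat_add_one_cpow h6, zetaSix,
      Complex.ofReal_tsum]
    refine tsum_congr fun n => ?_
    push_cast
    congr 1
    exact_mod_cast Complex.cpow_natCast ((n : ℂ) + 1) 6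
  have h2 : LSeries (fun n => ((ArithmeticFunction.moebius n : ℤ) : ℂ)) (6 : ℂ)
      = ((∑' d : ℕ, (ArithmeticFunction.moebius d : ℝ) / (d : ℝ) ^ 6 : ℝ) : ℂ) := by
    rw [LSeries, Complex.ofReal_tsum]
    refine tsum_congr fun n => ?_
    rcases eq_or_ne n 0 with rfl | hn
    · simp
    rw [LSeries.term_of_ne_zero hn]
    push_cast
    congr 1
    exact_mod_cast Complex.cpow_natCast (n : ℂ) 6
  rw [h1, h2] at h
  exact_mod_cast h

lemma exists_max_fourth (g : ℕ) (hg : g ≠ 0) :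
    ∃ D : ℕ, D ≠ 0 ∧ ∀ d : ℕ, d ^ 4 ∣ g ↔ d ∣ D := by
  have hb : ∀ d : ℕ, d ^ 4 ∣ g → d ≤ g := fun d hd =>
    (Nat.le_self_pow (by norm_num) d).trans (Nat.le_of_dvd (Nat.pos_of_ne_zero hg) hd)
  let D := Nat.findGreatest (fun d => d ^ 4 ∣ g) g
  have hD : D ^ 4 ∣ g :=
    Nat.findGreatest_spec (P := fun d => d ^ 4 ∣ g) (m := 1) (Nat.pos_of_ne_zero hg) (by simp)
  have hD0 : D ≠ 0 := by
    rintro h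
    rw [h] at hD
    simp at hD
    exact hg hD
  refine ⟨D, hD0, fun d => ⟨fun hd => ?_, fun hd => (pow_dvd_pow_of_dvd hd 4).trans hD⟩⟩
  have hl : (Nat.lcm d D) ^ 4 ∣ g := by
    rw [← Nat.pow_lcm_pow]
    exact Nat.lcm_dvd hd hD
  have hle : Nat.lcm d D ≤ D :=
    Nat.le_findGreatest (P := fun d => d ^ 4 ∣ g) (hb _ hl) hl
  have : Nat.lcm d D = D :=
    le_antisymm hle (Nat.le_of_dvd (Nat.pos_of_ne_zero (by
      intro h0; rw [h0] at hl; simp at hl; exact hg hl)) (Nat.dvd_lcm_right d D))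
  rw [← this]
  exact Nat.dvd_lcm_left d D

open Classical in
lemma moebius_prim (A B : ℤ) (h : (A, B) ≠ (0, 0)) (N : ℕ) (hN : A.natAbs + B.natAbs ≤ N) :
    ∑ d ∈ Finset.range (N + 1), (if ((d : ℤ) ^ 2 ∣ A ∧ (d : ℤ) ^ 4 ∣ B) then
      ArithmeticFunction.moebius d else 0) = if PrimPair A B then 1 else 0 := by
  set g := Nat.gcd (A.natAbs ^ 2) B.natAbs with hg
  have hg0 : g ≠ 0 := by
    intro h0
    rw [hg, Nat.gcd_eq_zero_iff] at h0
    apply h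
    simpa using h0
  obtain ⟨D, hD0, hD⟩ := exists_max_fourth g hg0
  have key : ∀ d : ℕ, ((d : ℤ) ^ 2 ∣ A ∧ (d : ℤ) ^ 4 ∣ B) ↔ d ∣ D := by
    intro d
    rw [← hD, hg, Nat.dvd_gcd_iff]
    refine and_congr ?_ ?_
    · rw [show d ^ 4 = (d ^ 2) ^ 2 by ring, Nat.pow_dvd_pow_iff (by norm_num),
        ← Int.natCast_dvd]
      push_cast
      rfl
    · rw [← Int.natCast_dvd]
      push_cast
      rfl
  have hbd : ∀ d : ℕ, d ∣ D → d ≤ N := by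
    intro d hd
    obtain ⟨h1, h2⟩ := (key d).2 hd
    have h1' : d ^ 2 ∣ A.natAbs := by rw [← Int.natCast_dvd]; exact_mod_cast h1
    have h2' : d ^ 4 ∣ B.natAbs := by rw [← Int.natCast_dvd]; exact_mod_cast h2
    by_cases hA : A = 0
    · have hB : B ≠ 0 := by rintro rfl; exact h (by rw [hA])
      have := Nat.le_of_dvd (Int.natAbs_pos.2 hB) h2'
      have := Nat.le_self_pow (n := 4) (by norm_num) d
      omega
    · have := Nat.le_of_dvd (Int.natAbs_pos.2 hA) h1'
      have := Nat.le_self_pow (n := 2) (by norm_num) d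
      omega
  simp_rw [key]
  rw [← Finset.sum_filter]
  have hs : (Finset.range (N + 1)).filter (fun d => d ∣ D) = D.divisors := by
    ext d
    simp only [Finset.mem_filter, Finset.mem_range, Nat.mem_divisors]
    constructor
    · rintro ⟨_, h⟩; exact ⟨h, hD0⟩
    · rintro ⟨h, _⟩; exact ⟨Nat.lt_succ_of_le (hbd d h), h⟩
  rw [hs, ← ArithmeticFunction.coe_mul_zeta_apply, ArithmeticFunction.moebius_mul_coe_zeta,
    ArithmeticFunction.one_apply]
  refine if_congr ?_ rfl rfl
  constructor
  · rintro h1 p hp hB hA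
    have := (key p).1 ⟨hA, hB⟩
    rw [h1] at this
    exact hp.one_lt.ne' (Nat.dvd_one.1 this)
  · intro hp
    by_contra hne
    obtain ⟨p, pp, hpd⟩ := Nat.exists_prime_and_dvd hne
    obtain ⟨h1, h2⟩ := (key p).2 hpd
    exact hp p pp h2 h1

lemma card_mult (m k : ℕ) (hk : 0 < k) :
    ((Finset.Icc (-(m : ℤ)) m).filter (fun A => (k : ℤ) ∣ A)).card = 2 * (m / k) + 1 := by
  have hk' : (0 : ℤ) < k := by exact_mod_cast hk
  have : (Finset.Icc (-(m : ℤ)) m).filter (fun A => (k : ℤ) ∣ A)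
      = (Finset.Icc (-((m / k : ℕ) : ℤ)) ((m / k : ℕ) : ℤ)).image (fun c => (k : ℤ) * c) := by
    ext A
    simp only [Finset.mem_filter, Finset.mem_Icc, Finset.mem_image]
    push_cast
    constructor
    · rintro ⟨⟨h1, h2⟩, c, rfl⟩
      refine ⟨c, ⟨?_, ?_⟩, rfl⟩
      · rw [neg_le, Int.le_ediv_iff_mul_le hk']; linarith
      · rw [Int.le_ediv_iff_mul_le hk']; linarith
    · rintro ⟨c, ⟨h1, h2⟩, rfl⟩
      rw [neg_le, Int.le_ediv_iff_mul_le hk'] at h1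
      rw [Int.le_ediv_iff_mul_le hk'] at h2
      exact ⟨⟨by linarith, by linarith⟩, dvd_mul_right _ _⟩
  rw [this, Finset.card_image_of_injective _ (mul_right_injective₀ hk'.ne')]
  simp only [Int.card_Icc]
  omega

/-- number of nonzero pairs in the box divisible by `(d², d⁴)` -/
def TT (m n d : ℕ) : ℕ := 4 * (m / d ^ 2) * (n / d ^ 4) + 2 * (m / d ^ 2) + 2 * (n / d ^ 4)

/-- the box -/
noncomputable def box (m n : ℕ) : Finset (ℤ × ℤ) :=
  (Finset.Icc (-(m : ℤ)) m) ×ˢ (Finset.Icc (-(n : ℤ)) n)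

open Classical in
lemma card_box_mult (m n d : ℕ) (hd : 0 < d) :
    (((box m n).erase (0, 0)).filter
      (fun P => (d : ℤ) ^ 2 ∣ P.1 ∧ (d : ℤ) ^ 4 ∣ P.2)).card = TT m n d := by
  rw [Finset.filter_erase, Finset.card_erase_of_mem (by simp [box]), box,
    Finset.filter_product (fun A => (d : ℤ) ^ 2 ∣ A) (fun B => (d : ℤ) ^ 4 ∣ B),
    Finset.card_product]
  have h1 := card_mult m (d ^ 2) (by positivity)
  have h2 := card_mult n (d ^ 4) (by positivity)
  push_cast at h1 h2
  rw [h1, h2, TT]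
  rw [Nat.sub_eq_iff_eq_add (by nlinarith [Nat.zero_le (m / d^2), Nat.zero_le (n/d^4)])]
  ring

open Classical in
lemma card_prim (m n : ℕ) :
    ((((box m n).filter (fun P => PrimPair P.1 P.2)).card : ℤ)) =
      ∑ d ∈ Finset.range (m + n + 1), ArithmeticFunction.moebius d * (TT m n d : ℤ) := by
  have h0 : (box m n).filter (fun P => PrimPair P.1 P.2)
      = ((box m n).erase (0, 0)).filter (fun P => PrimPair P.1 P.2) := by
    rw [Finset.filter_erase, Finset.erase_eq_of_notMem]
    simp only [Finset.mem_filter, not_and]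
    intro _ h
    exact h 2 Nat.prime_two (dvd_zero _) (dvd_zero _)
  rw [h0, Finset.card_filter]
  push_cast
  have h1 : ∀ P ∈ (box m n).erase (0, 0), (if PrimPair P.1 P.2 then (1 : ℤ) else 0) =
      ∑ d ∈ Finset.range (m + n + 1), (if ((d : ℤ) ^ 2 ∣ P.1 ∧ (d : ℤ) ^ 4 ∣ P.2) then
      ArithmeticFunction.moebius d else 0) := by
    rintro ⟨A, B⟩ hP
    rw [Finset.mem_erase, box, Finset.mem_product, Finset.mem_Icc, Finset.mem_Icc] at hP
    rw [moebius_prim A B hP.1 (m + n)]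
    obtain ⟨_, ⟨h1, h2⟩, h3, h4⟩ := hP
    simp only at h1 h2 h3 h4
    omega
  rw [Finset.sum_congr rfl h1, Finset.sum_comm]
  refine Finset.sum_congr rfl fun d _ => ?_
  rcases Nat.eq_zero_or_pos d with rfl | hd
  · simp
  rw [← Finset.sum_filter, Finset.sum_const, card_box_mult m n d hd, nsmul_eq_mul, mul_comm]

lemma card_prim_tsum (m n : ℕ) :
    ∑' d : ℕ, (ArithmeticFunction.moebius d : ℝ) * (TT m n d : ℝ) =
    ∑ d ∈ Finset.range (m + n + 1), (ArithmeticFunction.moebius d : ℝ) * (TT m n d : ℝ) := by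
  refine tsum_eq_sum fun d hd => ?_
  rw [Finset.mem_range, not_lt] at hd
  have h2 := Nat.le_self_pow (n := 2) (by norm_num) d
  have h4 := Nat.le_self_pow (n := 4) (by norm_num) d
  have : TT m n d = 0 := by
    rw [TT, Nat.div_eq_of_lt (by omega), Nat.div_eq_of_lt (by omega)]
  simp [this]

lemma tendsto_natdiv (k : ℕ) :
    Tendsto (fun X : ℝ => ((⌊X⌋₊ / k : ℕ) : ℝ) / X) atTop (nhds (1 / (k : ℝ))) := by
  have h := tendsto_nat_floor_mul_div_atTop (R := ℝ) (a := 1 / (k : ℝ)) (by positivity)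
  refine h.congr fun X => ?_
  rw [← Nat.floor_div_natCast, one_div_mul_eq_div]

lemma natdiv_le (k : ℕ) (X : ℝ) (hX : 1 ≤ X) :
    ((⌊X⌋₊ / k : ℕ) : ℝ) / X ≤ 1 / (k : ℝ) := by
  rw [← Nat.floor_div_natCast, div_le_iff₀ (by linarith), one_div_mul_eq_div]
  exact Nat.floor_le (by positivity)

lemma TT_div (X : ℝ) (hX : 1 ≤ X) (d : ℕ) :
    (TT ⌊X⌋₊ ⌊√X⌋₊ d : ℝ) / (X * √X) =
      4 * (((⌊X⌋₊ / d ^ 2 : ℕ) : ℝ) / X) * (((⌊√X⌋₊ / d ^ 4 : ℕ) : ℝ) / √X)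
      + 2 * (((⌊X⌋₊ / d ^ 2 : ℕ) : ℝ) / X) * (√X)⁻¹
      + 2 * (((⌊√X⌋₊ / d ^ 4 : ℕ) : ℝ) / √X) * X⁻¹ := by
  have h1 : 0 < X := by linarith
  have h2 : 0 < √X := Real.sqrt_pos.2 h1
  rw [TT, Nat.cast_add, Nat.cast_add, Nat.cast_mul, Nat.cast_mul, Nat.cast_mul, Nat.cast_mul]
  generalize ((⌊X⌋₊ / d ^ 2 : ℕ) : ℝ) = a
  generalize ((⌊√X⌋₊ / d ^ 4 : ℕ) : ℝ) = b
  push_cast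
  generalize √X = s at *
  field_simp

lemma tendsto_main :
    Tendsto (fun X : ℝ => ∑' d : ℕ, (ArithmeticFunction.moebius d : ℝ) *
      ((TT ⌊X⌋₊ ⌊√X⌋₊ d : ℝ) / (X * √X))) atTop
      (nhds (∑' d : ℕ, (ArithmeticFunction.moebius d : ℝ) * (4 / (d : ℝ) ^ 6))) := by
  refine tendsto_tsum_of_dominated_convergence (bound := fun d : ℕ => 8 * (1 / (d : ℝ) ^ 2)) ?_ ?_ ?_
  · exact (Real.summable_one_div_nat_pow.2 (by norm_num)).mul_left 8
  · intro d
    refine Tendsto.const_mul _ ?_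
    have hu := tendsto_natdiv (d ^ 2)
    have hv := (tendsto_natdiv (d ^ 4)).comp Real.tendsto_sqrt_atTop
    have hs : Tendsto (fun X : ℝ => (√X)⁻¹) atTop (nhds 0) :=
      tendsto_inv_atTop_zero.comp Real.tendsto_sqrt_atTop
    have hx : Tendsto (fun X : ℝ => X⁻¹) atTop (nhds 0) := tendsto_inv_atTop_zero
    have := (((hu.const_mul 4).mul hv).add ((hu.const_mul 2).mul hs)).add
      ((hv.const_mul 2).mul hx)
    have e : 4 * (1 / ((d ^ 2 : ℕ) : ℝ)) * (1 / ((d ^ 4 : ℕ) : ℝ))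
        + 2 * (1 / ((d ^ 2 : ℕ) : ℝ)) * 0 + 2 * (1 / ((d ^ 4 : ℕ) : ℝ)) * 0
        = 4 / (d : ℝ) ^ 6 := by
      push_cast
      rcases eq_or_ne (d : ℝ) 0 with h | h
      · simp [h]
      · field_simp; ring
    rw [e] at this
    refine this.congr' ?_
    filter_upwards [eventually_ge_atTop 1] with X hX
    rw [TT_div X hX]
    rfl
  · filter_upwards [eventually_ge_atTop 1] with X hX d
    have h1 : 0 < X := by linarith
    have h2 : 1 ≤ √X := Real.one_le_sqrt.2 hX
    have hmu : |(ArithmeticFunction.moebius d : ℝ)| ≤ 1 := by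
      exact_mod_cast ArithmeticFunction.abs_moebius_le_one (n := d)
    rw [Real.norm_eq_abs, abs_mul, abs_of_nonneg (a := (TT _ _ _ : ℝ) / _) (by positivity)]
    refine (mul_le_of_le_one_left (by positivity) hmu).trans ?_
    rw [TT_div X hX]
    have hu := natdiv_le (d ^ 2) X hX
    have hv := natdiv_le (d ^ 4) (√X) h2
    have hu0 : 0 ≤ ((⌊X⌋₊ / d ^ 2 : ℕ) : ℝ) / X := by positivity
    have hv0 : 0 ≤ ((⌊√X⌋₊ / d ^ 4 : ℕ) : ℝ) / √X := by positivity
    generalize ((⌊X⌋₊ / d ^ 2 : ℕ) : ℝ) / X = u at *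
    generalize ((⌊√X⌋₊ / d ^ 4 : ℕ) : ℝ) / √X = v at *
    have hs : (√X)⁻¹ ≤ 1 := inv_le_one_of_one_le₀ h2
    have hx : X⁻¹ ≤ 1 := inv_le_one_of_one_le₀ hX
    push_cast at hu hv
    have hle : 1 / (d : ℝ) ^ 4 ≤ 1 / (d : ℝ) ^ 2 ∧ 1 / (d : ℝ) ^ 4 ≤ 1 := by
      rcases Nat.eq_zero_or_pos d with rfl | hd
      · simp
      have hd1 : (1 : ℝ) ≤ d := by exact_mod_cast hd
      constructor
      · apply one_div_le_one_div_of_le (by positivity)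
        exact pow_le_pow_right₀ hd1 (by norm_num)
      · rw [div_le_one (by positivity)]
        exact one_le_pow₀ hd1
    have a1 : u * v ≤ u := mul_le_of_le_one_right hu0 (hv.trans hle.2)
    have a2 : u * (√X)⁻¹ ≤ u := mul_le_of_le_one_right hu0 hs
    have a3 : v * X⁻¹ ≤ v := mul_le_of_le_one_right hv0 hx
    nlinarith [hle.1]

open Classical in
lemma ncard_bounds (X : ℝ) (hX : 1 ≤ X) :
    ((curveFamily X).ncard : ℝ) ≤
      (((box ⌊X⌋₊ ⌊√X⌋₊).filter (fun P => PrimPair P.1 P.2)).card : ℝ) ∧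
    (((box ⌊X⌋₊ ⌊√X⌋₊).filter (fun P => PrimPair P.1 P.2)).card : ℝ) ≤
      (curveFamily X).ncard + 3 * X := by
  set S := (box ⌊X⌋₊ ⌊√X⌋₊).filter (fun P => PrimPair P.1 P.2) with hS
  have hX0 : 0 ≤ X := by linarith
  have hc : ∀ (a : ℤ) (Y : ℝ), 0 ≤ Y → (|(a : ℝ)| ≤ Y ↔ a ∈ Finset.Icc (-(⌊Y⌋₊ : ℤ)) ⌊Y⌋₊) := by
    intro a Y hY
    rw [Finset.mem_Icc, ← abs_le, Int.abs_eq_natAbs, Nat.cast_le, Nat.le_floor_iff hY,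
      Nat.cast_natAbs, Int.cast_abs]
  have hset : curveFamily X = ((S.filter (fun P => P.1 ^ 2 - 4 * P.2 ≠ 0) : Finset (ℤ × ℤ)) : Set (ℤ × ℤ)) := by
    ext ⟨A, B⟩
    simp only [curveFamily, Set.mem_ofPred_eq, Finset.coe_filter, hS, Finset.mem_filter, box,
      Finset.mem_product]
    rw [← hc A X hX0, ← hc B _ (Real.sqrt_nonneg X), Real.le_sqrt (abs_nonneg _) hX0, sq_abs]
    unfold PrimPair
    tauto
  rw [hset, Set.ncard_coe_finset]
  constructor
  · exact_mod_cast Finset.card_filter_le _ _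
  · have h1 := Finset.card_filter_add_card_filter_not (s := S) (fun P => P.1 ^ 2 - 4 * P.2 ≠ 0)
    have h2 : (S.filter (fun P => ¬ (P.1 ^ 2 - 4 * P.2 ≠ 0))).card
        ≤ (Finset.Icc (-(⌊X⌋₊ : ℤ)) ⌊X⌋₊).card := by
      refine Finset.card_le_card_of_injOn Prod.fst ?_ ?_
      · intro P hP
        simp only [hS, Finset.coe_filter, Finset.mem_filter, box, Finset.mem_product,
          Set.mem_ofPred_eq] at hP
        exact hP.1.1.1
      · rintro ⟨a, b⟩ hP ⟨c, d⟩ hQ h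
        simp only [Finset.coe_filter, Set.mem_ofPred_eq, not_not] at hP hQ h
        obtain ⟨_, hP⟩ := hP
        obtain ⟨_, hQ⟩ := hQ
        subst h
        ext
        · rfl
        · simp only; omega
    rw [Int.card_Icc] at h2
    have h3 : (S.filter (fun P => ¬ (P.1 ^ 2 - 4 * P.2 ≠ 0))).card ≤ 2 * ⌊X⌋₊ + 1 := by omega
    have h4 : ((S.filter (fun P => ¬ (P.1 ^ 2 - 4 * P.2 ≠ 0))).card : ℝ) ≤ 2 * (⌊X⌋₊ : ℝ) + 1 := by
      exact_mod_cast h3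
    have h5 := Nat.floor_le hX0
    rw [← h1]
    push_cast
    linarith

open Classical in
lemma card_prim_real (X : ℝ) :
    (((box ⌊X⌋₊ ⌊√X⌋₊).filter (fun P => PrimPair P.1 P.2)).card : ℝ) / (X * √X) =
    ∑' d : ℕ, (ArithmeticFunction.moebius d : ℝ) * ((TT ⌊X⌋₊ ⌊√X⌋₊ d : ℝ) / (X * √X)) := by
  have h := card_prim ⌊X⌋₊ ⌊√X⌋₊
  have h' : (((box ⌊X⌋₊ ⌊√X⌋₊).filter (fun P => PrimPair P.1 P.2)).card : ℝ) =
      ∑ d ∈ Finset.range (⌊X⌋₊ + ⌊√X⌋₊ + 1), (ArithmeticFunction.moebius d : ℝ) *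
        (TT ⌊X⌋₊ ⌊√X⌋₊ d : ℝ) := by exact_mod_cast h
  rw [h', ← card_prim_tsum, ← tsum_div_const]
  simp_rw [mul_div_assoc]

/-- `#𝓔(X) ~ 4 X^{3/2} / ζ(6)` as `X → ∞`. -/
theorem count_curveFamily_asymptotic :
    Tendsto (fun X : ℝ =>
      ((curveFamily X).ncard : ℝ) / (4 * X ^ ((3 : ℝ) / 2) / zetaSix))
      atTop (nhds 1) := by
  classical
  set M := ∑' d : ℕ, (ArithmeticFunction.moebius d : ℝ) / (d : ℝ) ^ 6 with hM
  have hz : zetaSix * M = 1 := zetaSix_mul_moebius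
  have hmain := tendsto_main
  have e : ∑' d : ℕ, (ArithmeticFunction.moebius d : ℝ) * (4 / (d : ℝ) ^ 6) = 4 * M := by
    rw [hM, ← tsum_mul_left]
    exact tsum_congr fun d => by ring
  rw [e] at hmain
  have hs : Tendsto (fun X : ℝ => 3 * (√X)⁻¹) atTop (nhds 0) := by
    simpa using (tendsto_inv_atTop_zero.comp Real.tendsto_sqrt_atTop).const_mul (3 : ℝ)
  have hlow := hmain.sub hs
  rw [sub_zero] at hlow
  have hq : Tendsto (fun X : ℝ => ((curveFamily X).ncard : ℝ) / (X * √X)) atTop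
      (nhds (4 * M)) := by
    refine tendsto_of_tendsto_of_tendsto_of_le_of_le' hlow hmain ?_ ?_
    · filter_upwards [eventually_ge_atTop 1] with X hX
      have h2 : 0 < √X := Real.sqrt_pos.2 (by linarith)
      have h1 : 0 < X := by linarith
      have e3 : 3 * (√X)⁻¹ = 3 * X / (X * √X) := by field_simp
      rw [← card_prim_real, e3, ← sub_div]
      have := (ncard_bounds X hX).2
      gcongr
      linarith
    · filter_upwards [eventually_ge_atTop 1] with X hX
      rw [← card_prim_real]
      have := (ncard_bounds X hX).1
      gcongr
  have hfin := hq.const_mul (zetaSix / 4)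
  have e2 : zetaSix / 4 * (4 * M) = 1 := by rw [← hz]; ring
  rw [e2] at hfin
  refine hfin.congr' ?_
  filter_upwards [eventually_ge_atTop 1] with X hX
  have hp : X ^ ((3 : ℝ) / 2) = X * √X := by
    rw [Real.sqrt_eq_rpow, show (3 : ℝ) / 2 = 1 + 1 / 2 by norm_num,
      Real.rpow_add (by linarith), Real.rpow_one]
  rw [hp, div_div_eq_mul_div, div_mul_eq_mul_div, mul_div_assoc', div_div, mul_comm zetaSix,
    mul_comm (X * √X)]
end

section
/- For a squarefree integer q and a residue pair (a,b) mod q, define δ(q;(a,b)) = ∏_{p ∣ q} δ(p;(a,b)), where δ(p;(a,b)) = p⁴/(p⁶−1) if p ∤ a or p ∤ b, and δ(p;(a,b)) = (p⁴−1)/(p⁶−1) if p ∣ a and p ∣ b. Then #{(A,B) ∈ 𝓔(X) : A ≡ a, B ≡ b (mod q)} = δ(q;(a,b)) · 4X^{3/2}/ζ(6) + O(q²X + q⁶X^{3/8}). -/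
/-- The local density `δ(q;(a,b)) = ∏_{p ∣ q} δ(p;(a,b))`, where `δ(p;(a,b)) = p⁴/(p⁶-1)`
if `p ∤ a` or `p ∤ b`, and `(p⁴-1)/(p⁶-1)` if `p ∣ a` and `p ∣ b`. -/
noncomputable def localDensity (q : ℕ) (a b : ℤ) : ℝ :=
  ∏ p ∈ q.primeFactors,
    (if (p : ℤ) ∣ a ∧ (p : ℤ) ∣ b then ((p : ℝ) ^ 4 - 1) / ((p : ℝ) ^ 6 - 1)
     else (p : ℝ) ^ 4 / ((p : ℝ) ^ 6 - 1))

section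
open Finset

theorem aux_sq_dvd (d : ℕ) (hd : Squarefree d) (k : ℕ) (A : ℤ)
    (h : ∀ p ∈ d.primeFactors, (p : ℤ) ^ k ∣ A) : (d : ℤ) ^ k ∣ A := by
  have h1 : (d : ℤ) ^ k = ∏ p ∈ d.primeFactors, (p : ℤ) ^ k := by
    rw [Finset.prod_pow]
    congr 1
    have := congrArg (Nat.cast : ℕ → ℤ) (Nat.prod_primeFactors_of_squarefree hd).symm
    rwa [Nat.cast_prod] at this
  rw [h1]
  apply Finset.prod_dvd_of_coprime _ h
  intro p hp r hr hne
  have hp' := Nat.prime_of_mem_primeFactors hp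
  have hr' := Nat.prime_of_mem_primeFactors hr
  have := (Nat.coprime_primes hp' hr').2 hne
  exact (Nat.isCoprime_iff_coprime.2 this).pow

open Classical in
theorem aux_mob (A B : ℤ) (hB : B ≠ 0) (D : ℕ) (hD : ∀ d : ℕ, (d : ℤ) ^ 4 ∣ B → d ≤ D) :
    ∑ d ∈ range (D + 1), (if (d : ℤ) ^ 2 ∣ A ∧ (d : ℤ) ^ 4 ∣ B then
      ((ArithmeticFunction.moebius d : ℤ) : ℝ) else 0) =
    if (∀ p : ℕ, p.Prime → (p : ℤ) ^ 4 ∣ B → ¬ (p : ℤ) ^ 2 ∣ A) then 1 else 0 := by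
  set P := B.natAbs.primeFactors.filter (fun p : ℕ => (p : ℤ) ^ 2 ∣ A ∧ (p : ℤ) ^ 4 ∣ B) with hP
  have hPmem : ∀ p : ℕ, p ∈ P ↔ p.Prime ∧ (p : ℤ) ^ 2 ∣ A ∧ (p : ℤ) ^ 4 ∣ B := by
    intro p
    rw [hP, mem_filter, Nat.mem_primeFactors]
    constructor
    · tauto
    · rintro ⟨h1, h2, h3⟩
      refine ⟨⟨h1, ?_, by simpa using hB⟩, h2, h3⟩
      rw [← Int.natCast_dvd]
      exact dvd_trans (dvd_pow_self _ (by norm_num)) h3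
  have hPp : ∀ p ∈ P, p.Prime := fun p hp => ((hPmem p).1 hp).1
  set m := ∏ p ∈ P, p with hm
  have hmpf : m.primeFactors = P := Nat.primeFactors_prod hPp
  have hm0 : m ≠ 0 := Finset.prod_ne_zero_iff.2 (fun p hp => (hPp p hp).ne_zero)
  have hmsq : Squarefree m := by
    rw [hm]
    apply Finset.squarefree_prod_of_pairwise_isCoprime
    · intro p hp r hr hne
      exact Nat.coprime_iff_isRelPrime.1 ((Nat.coprime_primes (hPp p hp) (hPp r hr)).2 hne)
    · intro p hp
      exact (hPp p hp).prime.squarefree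
  have key : ∀ d : ℕ, Squarefree d → (((d : ℤ) ^ 2 ∣ A ∧ (d : ℤ) ^ 4 ∣ B) ↔ d ∣ m) := by
    intro d hd
    constructor
    · rintro ⟨h1, h2⟩
      rw [← Nat.prod_primeFactors_of_squarefree hd, hm]
      apply Finset.prod_dvd_prod_of_subset
      intro p hp
      rw [hPmem]
      have hpd : (p : ℤ) ∣ d := by exact_mod_cast Nat.dvd_of_mem_primeFactors hp
      exact ⟨Nat.prime_of_mem_primeFactors hp, (pow_dvd_pow_of_dvd hpd 2).trans h1,
        (pow_dvd_pow_of_dvd hpd 4).trans h2⟩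
    · intro h
      have hs : ∀ p ∈ d.primeFactors, p ∈ P := by
        intro p hp
        rw [← hmpf]
        exact Nat.primeFactors_mono h hm0 hp
      exact ⟨aux_sq_dvd d hd 2 A fun p hp => ((hPmem p).1 (hs p hp)).2.1,
        aux_sq_dvd d hd 4 B fun p hp => ((hPmem p).1 (hs p hp)).2.2⟩
  have h1 : ∑ d ∈ range (D + 1), (if (d : ℤ) ^ 2 ∣ A ∧ (d : ℤ) ^ 4 ∣ B then
      ((ArithmeticFunction.moebius d : ℤ) : ℝ) else 0) =
      ∑ d ∈ m.divisors, ((ArithmeticFunction.moebius d : ℤ) : ℝ) := by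
    symm
    have hsub : m.divisors ⊆ range (D + 1) := by
      intro d hd
      have hd' := Nat.dvd_of_mem_divisors hd
      have := hD d ((key d (hmsq.squarefree_of_dvd hd')).2 hd').2
      simp; omega
    rw [← Finset.sum_subset hsub (f := fun d : ℕ => (if (d : ℤ) ^ 2 ∣ A ∧ (d : ℤ) ^ 4 ∣ B then
      ((ArithmeticFunction.moebius d : ℤ) : ℝ) else 0))]
    · apply Finset.sum_congr rfl
      intro d hd
      have hd' := Nat.dvd_of_mem_divisors hd
      rw [if_pos ((key d (hmsq.squarefree_of_dvd hd')).2 hd')]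
    · intro d _ hd
      by_cases hsq : Squarefree d
      · rw [if_neg]
        rw [key d hsq]
        intro h
        exact hd (Nat.mem_divisors.2 ⟨h, hm0⟩)
      · simp [ArithmeticFunction.moebius_eq_zero_of_not_squarefree hsq]
  rw [h1]
  have h2 : ∑ d ∈ m.divisors, ArithmeticFunction.moebius d = if m = 1 then 1 else 0 := by
    rw [← ArithmeticFunction.coe_zeta_mul_apply, ArithmeticFunction.coe_zeta_mul_moebius,
      ArithmeticFunction.one_apply]
  have h3 : (m = 1) ↔ (∀ p : ℕ, p.Prime → (p : ℤ) ^ 4 ∣ B → ¬ (p : ℤ) ^ 2 ∣ A) := by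
    constructor
    · intro h p hp h4 h2
      have : p ∈ m.primeFactors := by rw [hmpf, hPmem]; exact ⟨hp, h2, h4⟩
      rw [h] at this; simp at this
    · intro h
      have : P = ∅ := by
        rw [Finset.eq_empty_iff_forall_notMem]
        intro p hp
        have := (hPmem p).1 hp
        exact h p this.1 this.2.2 this.2.1
      rw [hm, this]; simp
  rw [← Int.cast_sum, h2]
  simp only [h3]
  split_ifs <;> simp

theorem aux_ap (r : ℕ) (hr : 0 < r) (v : ℤ) (Y : ℝ) (hY : 0 ≤ Y) :
    |(#{x ∈ Icc (-⌊Y⌋) ⌊Y⌋ | x ≡ v [ZMOD (r : ℤ)]} : ℝ) - 2 * Y / r| ≤ 2 := by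
  have h0 : 0 ≤ ⌊Y⌋ := Int.floor_nonneg.2 hY
  have hI : Icc (-⌊Y⌋) ⌊Y⌋ = Ioc (-⌊Y⌋ - 1) ⌊Y⌋ := by
    ext x; rw [mem_Icc, mem_Ioc]; omega
  have hr' : (0 : ℤ) < r := by exact_mod_cast hr
  have hc := Int.Ioc_filter_modEq_card (-⌊Y⌋ - 1) ⌊Y⌋ hr' v
  rw [hI]
  have hrR : (1 : ℚ) ≤ r := by exact_mod_cast hr
  set n := ⌊Y⌋ with hn
  set c := #{x ∈ Ioc (-n - 1) n | x ≡ v [ZMOD (r : ℤ)]}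
  set u1 : ℚ := ((n : ℚ) - v) / ((r : ℤ) : ℚ)
  set u2 : ℚ := (((-n - 1 : ℤ) : ℚ) - v) / ((r : ℤ) : ℚ)
  have hu : u1 - u2 = (2 * n + 1) / r := by
    simp only [u1, u2]; push_cast; ring
  have hup : u2 ≤ u1 := by
    have : (0:ℚ) ≤ (2 * n + 1) / r := by
      have : (0:ℚ) ≤ n := by exact_mod_cast h0
      positivity
    linarith
  have hfl : ⌊u2⌋ ≤ ⌊u1⌋ := Int.floor_le_floor hup
  rw [max_eq_left (by linarith)] at hc
  have hcQ : (c : ℚ) = (⌊u1⌋ : ℚ) - ⌊u2⌋ := by exact_mod_cast hc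
  have a1 := Int.floor_le u1
  have a2 := Int.lt_floor_add_one u1
  have a3 := Int.floor_le u2
  have a4 := Int.lt_floor_add_one u2
  have b1 : (c : ℚ) ≤ (2 * n + 1) / r + 1 := by linarith
  have b2 : (2 * n + 1) / r - 1 ≤ (c : ℚ) := by linarith
  have b1' : (c : ℝ) ≤ (2 * n + 1) / r + 1 := by exact_mod_cast b1
  have b2' : (2 * n + 1) / r - 1 ≤ (c : ℝ) := by exact_mod_cast b2
  have f1 := Int.floor_le Y
  have f2 := Int.lt_floor_add_one Y
  have hrR' : (1 : ℝ) ≤ r := by exact_mod_cast hr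
  have g1 : (2 * (n:ℝ) + 1) / r ≤ 2 * Y / r + 1 := by
    rw [div_add' _ _ _ (by positivity)]
    gcongr
    linarith
  have g2 : 2 * Y / r - 1 ≤ (2 * (n:ℝ) + 1) / r := by
    rw [div_sub' (by positivity)]
    gcongr
    linarith
  rw [abs_le]; constructor <;> linarith

theorem aux_crt (m q : ℕ) (hm : 0 < m) (hq : 0 < q) (a : ℤ) (Y : ℝ) (hY : 0 ≤ Y)
    (hg : ((m.gcd q : ℕ) : ℤ) ∣ a) :
    |(#{x ∈ Icc (-⌊Y⌋) ⌊Y⌋ | (m : ℤ) ∣ x ∧ x ≡ a [ZMOD (q : ℤ)]} : ℝ)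
      - 2 * Y * (m.gcd q : ℕ) / (m * q)| ≤ 2 := by
  obtain ⟨k, hk⟩ := hg
  have hb := Nat.gcd_eq_gcd_ab m q
  set v : ℤ := m * m.gcdA q * k with hv
  have hv1 : (m : ℤ) ∣ v := ⟨m.gcdA q * k, by rw [hv]; ring⟩
  have hv2 : v ≡ a [ZMOD (q : ℤ)] := by
    rw [Int.modEq_iff_dvd]
    refine ⟨m.gcdB q * k, ?_⟩
    rw [hk, hb, hv]; ring
  have h := aux_ap (m.lcm q) (Nat.lcm_pos hm hq) v Y hY
  have e1 : ∀ x : ℤ, ((m : ℤ) ∣ x ∧ x ≡ a [ZMOD (q : ℤ)]) ↔ x ≡ v [ZMOD ((m.lcm q : ℕ) : ℤ)] := by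
    intro x
    have := @Int.modEq_and_modEq_iff_modEq_lcm x v m q
    rw [show ((m.lcm q : ℕ) : ℤ) = (((m : ℤ).lcm (q : ℤ) : ℕ) : ℤ) by rfl, ← this]
    apply and_congr
    · constructor
      · intro hx
        rw [Int.modEq_iff_dvd]; exact dvd_sub hv1 hx
      · intro hx
        rw [Int.modEq_iff_dvd] at hx
        have := dvd_sub hv1 hx
        simpa using this
    · exact ⟨fun hx => hx.trans hv2.symm, fun hx => hx.trans hv2⟩
  simp only [e1]
  have e2 : 2 * Y * (m.gcd q : ℕ) / (m * q) = 2 * Y / (m.lcm q : ℕ) := by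
    have : ((m.gcd q : ℕ) : ℝ) * (m.lcm q : ℕ) = m * q := by exact_mod_cast Nat.gcd_mul_lcm m q
    rw [← this]
    have h1 : ((m.gcd q : ℕ) : ℝ) ≠ 0 := by
      exact_mod_cast (Nat.gcd_pos_of_pos_left q hm).ne'
    have h2 : ((m.lcm q : ℕ) : ℝ) ≠ 0 := by
      exact_mod_cast (Nat.lcm_pos hm hq).ne'
    field_simp
  rw [e2]; exact h

theorem aux_gcd (d q k : ℕ) (hk : k ≠ 0) (hq : Squarefree q) : (d ^ k).gcd q = d.gcd q := by
  apply Nat.dvd_antisymm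
  · apply Nat.dvd_gcd _ (Nat.gcd_dvd_right _ _)
    have hs : Squarefree ((d ^ k).gcd q) := hq.squarefree_of_dvd (Nat.gcd_dvd_right _ _)
    exact (hs.dvd_pow_iff_dvd hk).1 (Nat.gcd_dvd_left _ _)
  · exact Nat.gcd_dvd_gcd_of_dvd_left _ (dvd_pow_self _ hk)

theorem aux_crt_none (m q : ℕ) (a : ℤ) (s : Finset ℤ)
    (hg : ¬ ((m.gcd q : ℕ) : ℤ) ∣ a) :
    #{x ∈ s | (m : ℤ) ∣ x ∧ x ≡ a [ZMOD (q : ℤ)]} = 0 := by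
  rw [Finset.card_eq_zero, Finset.filter_eq_empty_iff]
  rintro x _ ⟨h1, h2⟩
  apply hg
  have g1 : ((m.gcd q : ℕ) : ℤ) ∣ x := (Int.natCast_dvd_natCast.2 (Nat.gcd_dvd_left m q)).trans h1
  have g2 : ((m.gcd q : ℕ) : ℤ) ∣ a - x :=
    (Int.natCast_dvd_natCast.2 (Nat.gcd_dvd_right m q)).trans ((Int.modEq_iff_dvd).1 h2)
  have := dvd_add g1 g2
  simpa using this

/-- Coefficient of the main term. -/
noncomputable def fcoef (q : ℕ) (a b : ℤ) (d : ℕ) : ℝ :=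
  if ((d.gcd q : ℕ) : ℤ) ∣ a ∧ ((d.gcd q : ℕ) : ℤ) ∣ b then
    ((ArithmeticFunction.moebius d : ℤ) : ℝ) * (d.gcd q : ℕ) ^ 2 / (d : ℝ) ^ 6 else 0

theorem abs_moebius_le (d : ℕ) : |((ArithmeticFunction.moebius d : ℤ) : ℝ)| ≤ 1 := by
  have := ArithmeticFunction.abs_moebius_le_one (n := d)
  exact_mod_cast this

theorem fcoef_bound (q : ℕ) (hq : q ≠ 0) (a b : ℤ) (d : ℕ) :
    ‖fcoef q a b d‖ ≤ (q : ℝ) ^ 2 * (1 / (d : ℝ) ^ 6) := by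
  unfold fcoef
  split_ifs
  · rw [Real.norm_eq_abs, abs_div, abs_mul, mul_one_div, abs_of_nonneg (by positivity : 0 ≤ (d : ℝ) ^ 6)]
    gcongr
    have h1 := abs_moebius_le d
    have h2 : ((d.gcd q : ℕ) : ℝ) ≤ q := by
      exact_mod_cast Nat.le_of_dvd (Nat.pos_of_ne_zero hq) (Nat.gcd_dvd_right d q)
    rw [abs_of_nonneg (by positivity : 0 ≤ ((d.gcd q : ℕ) : ℝ) ^ 2)]
    calc _ ≤ 1 * (q : ℝ) ^ 2 := by gcongr
      _ = _ := one_mul _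
  · simp; positivity

theorem fcoef_summable (q : ℕ) (hq : q ≠ 0) (a b : ℤ) : Summable (fun d => ‖fcoef q a b d‖) := by
  apply Summable.of_nonneg_of_le (fun d => norm_nonneg _) (fcoef_bound q hq a b)
  apply Summable.mul_left
  exact Real.summable_one_div_nat_pow.2 (by norm_num)

theorem fcoef_mul (q : ℕ) (a b : ℤ) {m n : ℕ} (h : m.Coprime n) :
    fcoef q a b (m * n) = fcoef q a b m * fcoef q a b n := by
  have hg : (m * n).gcd q = m.gcd q * n.gcd q := by
    rw [Nat.gcd_comm, Nat.Coprime.gcd_mul q h, Nat.gcd_comm q m, Nat.gcd_comm q n]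
  have hco : IsCoprime ((m.gcd q : ℕ) : ℤ) ((n.gcd q : ℕ) : ℤ) := by
    rw [Nat.isCoprime_iff_coprime]
    exact Nat.Coprime.coprime_dvd_left (Nat.gcd_dvd_left _ _)
      (Nat.Coprime.coprime_dvd_right (Nat.gcd_dvd_left _ _) h)
  have hd : ∀ z : ℤ, (((m * n).gcd q : ℕ) : ℤ) ∣ z ↔
      ((m.gcd q : ℕ) : ℤ) ∣ z ∧ ((n.gcd q : ℕ) : ℤ) ∣ z := by
    intro z
    rw [hg]; push_cast
    constructor
    · intro hz
      exact ⟨(dvd_mul_right _ _).trans hz, (dvd_mul_left _ _).trans hz⟩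
    · rintro ⟨h1, h2⟩
      exact hco.mul_dvd h1 h2
  have hmu := ArithmeticFunction.isMultiplicative_moebius.map_mul_of_coprime h
  unfold fcoef
  simp only [hd]
  by_cases h1 : ((m.gcd q : ℕ) : ℤ) ∣ a ∧ ((m.gcd q : ℕ) : ℤ) ∣ b
  · by_cases h2 : ((n.gcd q : ℕ) : ℤ) ∣ a ∧ ((n.gcd q : ℕ) : ℤ) ∣ b
    · rw [if_pos h1, if_pos h2, if_pos (by tauto), hmu, hg]
      push_cast
      rw [div_mul_div_comm]
      congr 1 <;> ring
    · rw [if_neg h2, if_neg (by tauto), mul_zero]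
  · rw [if_neg h1, if_neg (by tauto), zero_mul]

theorem fcoef_one (q : ℕ) (a b : ℤ) : fcoef q a b 1 = 1 := by simp [fcoef]

theorem fcoef_zero (q : ℕ) (a b : ℤ) : fcoef q a b 0 = 0 := by simp [fcoef]

theorem fcoef_local (q : ℕ) (a b : ℤ) (p : ℕ) (hp : p.Prime) :
    ∑' e : ℕ, fcoef q a b (p ^ e) = 1 + fcoef q a b p := by
  rw [tsum_eq_sum (s := range 2)]
  · simp [Finset.sum_range_succ, fcoef_one]
  · intro e he
    have he' : 2 ≤ e := by rw [mem_range] at he; omega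
    unfold fcoef
    have hmu : ArithmeticFunction.moebius (p ^ e) = 0 := by
      rw [ArithmeticFunction.moebius_apply_prime_pow hp (by omega)]
      exact if_neg (by omega)
    rw [hmu]
    simp

/-- The completely multiplicative function n⁻⁶. -/
noncomputable def invSix : ℕ →*₀ ℝ where
  toFun n := 1 / (n : ℝ) ^ 6
  map_zero' := by simp
  map_one' := by simp
  map_mul' m n := by push_cast; rw [mul_pow]; field_simp

theorem zetaSix_eq : zetaSix = ∑' n : ℕ, invSix n := by
  have hs : Summable (fun n : ℕ => 1 / (n : ℝ) ^ 6) :=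
    Real.summable_one_div_nat_pow.2 (by norm_num)
  have := hs.tsum_eq_zero_add
  simp only [zetaSix]
  change _ = ∑' n : ℕ, 1 / (n : ℝ) ^ 6
  rw [this]
  simp

theorem zetaSix_pos : 0 < zetaSix := by
  have hs : Summable (fun n : ℕ => 1 / ((n : ℝ) + 1) ^ 6) := by
    have := (summable_nat_add_iff 1).2 (Real.summable_one_div_nat_pow.2 (by norm_num : 1 < 6))
    simpa using this
  apply hs.tsum_pos (fun n => by positivity) 0
  norm_num

theorem fcoef_tsum (q : ℕ) (hq : Squarefree q) (a b : ℤ) :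
    zetaSix * ∑' d, fcoef q a b d = (q : ℝ) ^ 2 * localDensity q a b := by
  have H1 := EulerProduct.eulerProduct_hasProd_mulIndicator (fcoef_one q a b) (fcoef_mul q a b)
    (fcoef_summable q hq.ne_zero a b) (fcoef_zero q a b)
  have H2 := EulerProduct.eulerProduct_completely_multiplicative_hasProd (f := invSix) (by
    have : Summable (fun n : ℕ => ‖1 / (n : ℝ) ^ 6‖) :=
      (Real.summable_one_div_nat_pow.2 (by norm_num)).norm
    exact this)
  rw [← zetaSix_eq] at H2
  have H2' : HasProd (Set.mulIndicator {p | Nat.Prime p} (fun p : ℕ => (1 - invSix p)⁻¹)) zetaSix := by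
    rw [← hasProd_subtype_iff_mulIndicator]
    exact H2
  have H3 := H2'.mul H1
  have H4 := hasProd_prod_of_ne_finset_one (L := SummationFilter.unconditional ℕ)
    (s := q.primeFactors) (f := fun p =>
    Set.mulIndicator {p | Nat.Prime p} (fun p : ℕ => (1 - invSix p)⁻¹) p *
    Set.mulIndicator {p | Nat.Prime p} (fun p => ∑' e, fcoef q a b (p ^ e)) p) (by
      intro p hp
      by_cases hpp : p.Prime
      · have hpq : ¬ p ∣ q := fun h => hp (Nat.mem_primeFactors.2 ⟨hpp, h, hq.ne_zero⟩)
        rw [Set.mulIndicator_of_mem (by exact hpp), Set.mulIndicator_of_mem (by exact hpp),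
          fcoef_local q a b p hpp]
        have hg : p.gcd q = 1 := (Nat.Prime.coprime_iff_not_dvd hpp).2 hpq
        have : fcoef q a b p = - invSix p := by
          unfold fcoef
          rw [hg, ArithmeticFunction.moebius_apply_prime hpp]
          simp only [invSix]
          simp [neg_div]
        rw [this, ← sub_eq_add_neg]
        apply inv_mul_cancel₀
        have h2 : (1 : ℝ) < (p : ℝ) ^ 6 := one_lt_pow₀ (by exact_mod_cast hpp.one_lt) (by norm_num)
        have : invSix p < 1 := by
          change 1 / (p : ℝ) ^ 6 < 1
          rw [div_lt_one (by linarith)]; exact h2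
        linarith
      · rw [Set.mulIndicator_of_notMem (by exact hpp), Set.mulIndicator_of_notMem (by exact hpp),
          one_mul])
  rw [H3.unique H4]
  have hqp : (q : ℝ) ^ 2 = ∏ p ∈ q.primeFactors, (p : ℝ) ^ 2 := by
    rw [Finset.prod_pow]
    congr 1
    have := congrArg (Nat.cast : ℕ → ℝ) (Nat.prod_primeFactors_of_squarefree hq).symm
    rwa [Nat.cast_prod] at this
  rw [hqp, localDensity, ← Finset.prod_mul_distrib]
  apply Finset.prod_congr rfl
  intro p hp
  have hpp := Nat.prime_of_mem_primeFactors hp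
  have hpq := Nat.dvd_of_mem_primeFactors hp
  rw [Set.mulIndicator_of_mem (by exact hpp), Set.mulIndicator_of_mem (by exact hpp),
          fcoef_local q a b p hpp]
  unfold fcoef
  rw [Nat.gcd_eq_left hpq, ArithmeticFunction.moebius_apply_prime hpp]
  have h2 : (1 : ℝ) < (p : ℝ) ^ 6 := one_lt_pow₀ (by exact_mod_cast hpp.one_lt) (by norm_num)
  have h3 : (p : ℝ) ^ 6 - 1 ≠ 0 := by linarith
  have h4 : (p : ℝ) ≠ 0 := by exact_mod_cast hpp.ne_zero
  have h5 : (1 - invSix p)⁻¹ = (p : ℝ) ^ 6 / ((p : ℝ) ^ 6 - 1) := by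
    change (1 - 1 / (p : ℝ) ^ 6)⁻¹ = _
    rw [one_sub_div (by positivity), inv_div]
  rw [h5]
  split_ifs
  · push_cast; field_simp; ring
  · field_simp; ring

/-- Number of pairs divisible by d. -/
noncomputable def Npairs (q : ℕ) (a b : ℤ) (Y : ℝ) (d : ℕ) : ℝ :=
  (#{x ∈ Icc (-⌊Y ^ 2⌋) ⌊Y ^ 2⌋ | ((d ^ 2 : ℕ) : ℤ) ∣ x ∧ x ≡ a [ZMOD (q : ℤ)]} : ℝ) *
  (#{x ∈ (Icc (-⌊Y⌋) ⌊Y⌋).erase 0 | ((d ^ 4 : ℕ) : ℤ) ∣ x ∧ x ≡ b [ZMOD (q : ℤ)]} : ℝ)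

theorem Npairs_zero (q : ℕ) (a b : ℤ) (Y : ℝ) (d : ℕ) (h : Y < (d : ℝ) ^ 4) :
    Npairs q a b Y d = 0 := by
  unfold Npairs
  have : #{x ∈ (Icc (-⌊Y⌋) ⌊Y⌋).erase 0 | ((d ^ 4 : ℕ) : ℤ) ∣ x ∧ x ≡ b [ZMOD (q : ℤ)]} = 0 := by
    rw [Finset.card_eq_zero, Finset.filter_eq_empty_iff]
    rintro x hx ⟨h1, h2⟩
    rw [mem_erase, mem_Icc] at hx
    have h3 := Int.le_of_dvd (abs_pos.2 hx.1) ((dvd_abs _ _).2 h1)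
    have h4 : |x| ≤ ⌊Y⌋ := abs_le.2 hx.2
    have h5 := Int.le_floor.1 (h3.trans h4)
    push_cast at h5
    linarith
  rw [this]; simp

theorem Npairs_bound (q : ℕ) (hq : Squarefree q) (a b : ℤ) (Y : ℝ) (hY : 1 ≤ Y) (d : ℕ) :
    ‖((ArithmeticFunction.moebius d : ℤ) : ℝ) * Npairs q a b Y d -
      4 * Y ^ 3 / (q : ℝ) ^ 2 * fcoef q a b d‖ ≤ 16 * Y ^ 2 * (1 / (d : ℝ) ^ 2) := by
  rcases Nat.eq_zero_or_pos d with hd | hd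
  · subst hd; simp [fcoef_zero]
  have hq0 : 0 < q := Nat.pos_of_ne_zero hq.ne_zero
  have hdR : (1 : ℝ) ≤ d := by exact_mod_cast hd
  have hqR : (1 : ℝ) ≤ q := by exact_mod_cast hq0
  by_cases hg : ((d.gcd q : ℕ) : ℤ) ∣ a ∧ ((d.gcd q : ℕ) : ℤ) ∣ b
  · set g : ℝ := ((d.gcd q : ℕ) : ℝ) with hgdef
    have hg0 : 0 ≤ g := by positivity
    have hgq : g ≤ q := by
      rw [hgdef]; exact_mod_cast Nat.le_of_dvd hq0 (Nat.gcd_dvd_right d q)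
    have hgq1 : g / q ≤ 1 := by rw [div_le_one (by linarith)]; exact hgq
    have hf : fcoef q a b d = ((ArithmeticFunction.moebius d : ℤ) : ℝ) * (g ^ 2 / (d : ℝ) ^ 6) := by
      unfold fcoef; rw [if_pos hg]; ring
    set α : ℝ := 2 * Y ^ 2 / d ^ 2 * (g / q) with hα
    set β : ℝ := 2 * Y / d ^ 4 * (g / q) with hβ
    have hαβ : α * β = 4 * Y ^ 3 / (q : ℝ) ^ 2 * (g ^ 2 / (d : ℝ) ^ 6) := by
      rw [hα, hβ]; field_simp; ring
    have e : ((ArithmeticFunction.moebius d : ℤ) : ℝ) * Npairs q a b Y d -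
      4 * Y ^ 3 / (q : ℝ) ^ 2 * fcoef q a b d =
      ((ArithmeticFunction.moebius d : ℤ) : ℝ) * (Npairs q a b Y d - α * β) := by
      rw [hf, hαβ]; ring
    rw [e, norm_mul, Real.norm_eq_abs, Real.norm_eq_abs]
    have key : |Npairs q a b Y d - α * β| ≤ 16 * Y ^ 2 * (1 / (d : ℝ) ^ 2) := by
      have hα0 : 0 ≤ α := by positivity
      have hβ0 : 0 ≤ β := by positivity
      have hα1 : α ≤ 2 * Y ^ 2 / d ^ 2 := by
        rw [hα]; exact mul_le_of_le_one_right (by positivity) hgq1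
      have hβ1 : β ≤ 2 * Y / d ^ 4 := by
        rw [hβ]; exact mul_le_of_le_one_right (by positivity) hgq1
      rw [mul_one_div]
      by_cases hdY : Y < (d : ℝ) ^ 4
      · rw [Npairs_zero q a b Y d hdY, zero_sub, abs_neg, abs_of_nonneg (by positivity)]
        have hβ2 : β ≤ 2 := by
          refine hβ1.trans ?_
          rw [div_le_iff₀ (by positivity)]; linarith
        calc α * β ≤ 2 * Y ^ 2 / d ^ 2 * 2 := by gcongr
          _ = 4 * Y ^ 2 / d ^ 2 := by ring
          _ ≤ _ := by gcongr; norm_num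
      · push Not at hdY
        have hA := aux_crt (d ^ 2) q (by positivity) hq0 a (Y ^ 2) (by positivity)
          (by rw [aux_gcd d q 2 (by norm_num) hq]; exact hg.1)
        have hB := aux_crt (d ^ 4) q (by positivity) hq0 b Y (by positivity)
          (by rw [aux_gcd d q 4 (by norm_num) hq]; exact hg.2)
        rw [aux_gcd d q 2 (by norm_num) hq] at hA
        rw [aux_gcd d q 4 (by norm_num) hq] at hB
        unfold Npairs
        set cA := #{x ∈ Icc (-⌊Y ^ 2⌋) ⌊Y ^ 2⌋ | ((d ^ 2 : ℕ) : ℤ) ∣ x ∧ x ≡ a [ZMOD (q : ℤ)]}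
        set cB := #{x ∈ Icc (-⌊Y⌋) ⌊Y⌋ | ((d ^ 4 : ℕ) : ℤ) ∣ x ∧ x ≡ b [ZMOD (q : ℤ)]} with hcB
        set cB' := #{x ∈ (Icc (-⌊Y⌋) ⌊Y⌋).erase 0 | ((d ^ 4 : ℕ) : ℤ) ∣ x ∧ x ≡ b [ZMOD (q : ℤ)]}
          with hcB'
        have hle : cB' ≤ cB := card_le_card (filter_subset_filter _ (erase_subset _ _))
        have hle2 : cB ≤ cB' + 1 := by
          rw [hcB', filter_erase]
          have := Finset.pred_card_le_card_erase (a := (0 : ℤ))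
            (s := {x ∈ Icc (-⌊Y⌋) ⌊Y⌋ | ((d ^ 4 : ℕ) : ℤ) ∣ x ∧ x ≡ b [ZMOD (q : ℤ)]})
          omega
        have hleR : (cB' : ℝ) ≤ cB := by exact_mod_cast hle
        have hle2R : (cB : ℝ) ≤ cB' + 1 := by exact_mod_cast hle2
        have eA : 2 * Y ^ 2 * ((d.gcd q : ℕ) : ℝ) / (((d ^ 2 : ℕ) : ℝ) * q) = α := by
          rw [hα]; push_cast; field_simp; rfl
        have eB : 2 * Y * ((d.gcd q : ℕ) : ℝ) / (((d ^ 4 : ℕ) : ℝ) * q) = β := by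
          rw [hβ]; push_cast; field_simp; rfl
        rw [eA] at hA
        rw [eB] at hB
        have hB' : |(cB' : ℝ) - β| ≤ 3 := by
          rw [abs_le] at hB ⊢
          constructor <;> linarith
        have e2 : (cA : ℝ) * cB' - α * β = (cA - α) * (cB' - β) + α * (cB' - β) + β * (cA - α) := by
          ring
        have hd24 : (d : ℝ) ^ 2 ≤ (d : ℝ) ^ 4 := pow_le_pow_right₀ hdR (by norm_num)
        have hYY : Y ≤ Y ^ 2 := by nlinarith
        have hone : 1 ≤ Y ^ 2 / (d : ℝ) ^ 2 := by
          rw [one_le_div (by positivity)]; linarith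
        have hβ3 : 2 * Y / (d : ℝ) ^ 4 ≤ 2 * Y ^ 2 / (d : ℝ) ^ 2 := by gcongr
        rw [e2]
        calc _ ≤ |(cA - α) * (cB' - β)| + |α * (cB' - β)| + |β * (cA - α)| := abs_add_three _ _ _
          _ = |cA - α| * |cB' - β| + α * |cB' - β| + β * |cA - α| := by
            rw [abs_mul ((cA : ℝ) - α), abs_mul α, abs_mul β, abs_of_nonneg hα0, abs_of_nonneg hβ0]
          _ ≤ 2 * 3 + (2 * Y ^ 2 / d ^ 2) * 3 + (2 * Y ^ 2 / (d : ℝ) ^ 2) * 2 := by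
            have := hβ1.trans hβ3
            gcongr
          _ ≤ 16 * Y ^ 2 / (d : ℝ) ^ 2 := by
            rw [mul_div_assoc, mul_div_assoc]; linarith
    calc _ ≤ 1 * (16 * Y ^ 2 * (1 / (d : ℝ) ^ 2)) := by
          gcongr
          exact abs_moebius_le d
      _ = _ := one_mul _
  · have hf : fcoef q a b d = 0 := by unfold fcoef; rw [if_neg hg]
    have hN : Npairs q a b Y d = 0 := by
      unfold Npairs
      rw [not_and_or] at hg
      rcases hg with hg | hg
      · rw [aux_crt_none (d ^ 2) q a _ (by rw [aux_gcd d q 2 (by norm_num) hq]; exact hg)]; simp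
      · rw [aux_crt_none (d ^ 4) q b _ (by rw [aux_gcd d q 4 (by norm_num) hq]; exact hg)]; simp
    rw [hf, hN]; simp; positivity

/-- The minimality condition. -/
def MinPair (AB : ℤ × ℤ) : Prop :=
  ∀ p : ℕ, p.Prime → (p : ℤ) ^ 4 ∣ AB.2 → ¬ (p : ℤ) ^ 2 ∣ AB.1

/-- All pairs in the box with nonzero second coordinate in the class. -/
noncomputable def boxPairs (q : ℕ) (a b : ℤ) (Y : ℝ) : Finset (ℤ × ℤ) :=
  {AB ∈ Icc (-⌊Y ^ 2⌋) ⌊Y ^ 2⌋ ×ˢ (Icc (-⌊Y⌋) ⌊Y⌋).erase 0 |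
    AB.1 ≡ a [ZMOD (q : ℤ)] ∧ AB.2 ≡ b [ZMOD (q : ℤ)]}

open Classical in
theorem box_count (q : ℕ) (a b : ℤ) (Y : ℝ) (hY : 1 ≤ Y) :
    (#{AB ∈ boxPairs q a b Y | MinPair AB} : ℝ) =
      ∑' d, ((ArithmeticFunction.moebius d : ℤ) : ℝ) * Npairs q a b Y d := by
  rw [tsum_eq_sum (s := range (⌊Y⌋.toNat + 1))]
  · rw [Finset.card_filter]
    push_cast
    have h1 : ∀ AB ∈ boxPairs q a b Y, (if MinPair AB then (1 : ℝ) else 0) =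
        ∑ d ∈ range (⌊Y⌋.toNat + 1), (if (d : ℤ) ^ 2 ∣ AB.1 ∧ (d : ℤ) ^ 4 ∣ AB.2 then
      ((ArithmeticFunction.moebius d : ℤ) : ℝ) else 0) := by
      intro AB hAB
      rw [boxPairs, mem_filter, mem_product, mem_erase, mem_Icc, mem_Icc] at hAB
      rw [aux_mob AB.1 AB.2 hAB.1.2.1]
      · rfl
      · intro d hd
        have h3 := Int.le_of_dvd (abs_pos.2 hAB.1.2.1) ((dvd_abs _ _).2 hd)
        have h4 : |AB.2| ≤ ⌊Y⌋ := abs_le.2 hAB.1.2.2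
        have h5 : d ≤ d ^ 4 := Nat.le_self_pow (by norm_num) d
        have h6 : (d : ℤ) ≤ (d : ℤ) ^ 4 := by exact_mod_cast h5
        omega
    rw [Finset.sum_congr rfl h1, Finset.sum_comm]
    apply Finset.sum_congr rfl
    intro d _
    rw [← Finset.sum_filter, Finset.sum_const, nsmul_eq_mul, mul_comm]
    congr 1
    unfold Npairs
    rw [← Nat.cast_mul, ← Finset.card_product]
    congr 2
    ext AB
    simp only [boxPairs, mem_filter, mem_product]
    push_cast
    tauto
  · intro d hd
    rw [Npairs_zero, mul_zero]
    rw [mem_range] at hd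
    have h1 : ⌊Y⌋ < (d : ℤ) := by omega
    have h2 : Y < ((d : ℤ) : ℝ) := Int.floor_lt.1 h1
    have h3 : (d : ℝ) ≤ (d : ℝ) ^ 4 := by exact_mod_cast Nat.le_self_pow (by norm_num) d
    push_cast at h2
    linarith

open Classical in
theorem box_asymp (q : ℕ) (hq : Squarefree q) (a b : ℤ) (Y : ℝ) (hY : 1 ≤ Y) :
    |(#{AB ∈ boxPairs q a b Y | MinPair AB} : ℝ) - localDensity q a b * (4 * Y ^ 3 / zetaSix)| ≤
      16 * Y ^ 2 * ∑' d : ℕ, 1 / (d : ℝ) ^ 2 := by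
  have hs2 : Summable (fun d : ℕ => 1 / (d : ℝ) ^ 2) := Real.summable_one_div_nat_pow.2 (by norm_num)
  have hz := zetaSix_pos
  have hq0 : (q : ℝ) ≠ 0 := by exact_mod_cast hq.ne_zero
  have hmain : localDensity q a b * (4 * Y ^ 3 / zetaSix) =
      ∑' d, 4 * Y ^ 3 / (q : ℝ) ^ 2 * fcoef q a b d := by
    rw [tsum_mul_left]
    have h := fcoef_tsum q hq a b
    have h' : ∑' d, fcoef q a b d = (q : ℝ) ^ 2 * localDensity q a b / zetaSix := by
      rw [← h]; field_simp
    rw [h']; field_simp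
  rw [hmain, box_count q a b Y hY]
  have s2 : Summable (fun d => 4 * Y ^ 3 / (q : ℝ) ^ 2 * fcoef q a b d) :=
    (fcoef_summable q hq.ne_zero a b).of_norm.mul_left _
  have s3 : Summable (fun d => ((ArithmeticFunction.moebius d : ℤ) : ℝ) * Npairs q a b Y d -
      4 * Y ^ 3 / (q : ℝ) ^ 2 * fcoef q a b d) :=
    Summable.of_norm_bounded (hs2.mul_left (16 * Y ^ 2)) (Npairs_bound q hq a b Y hY)
  have s1 : Summable (fun d => ((ArithmeticFunction.moebius d : ℤ) : ℝ) * Npairs q a b Y d) := by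
    have := s3.add s2
    simpa using this
  rw [← s1.tsum_sub s2]
  exact tsum_of_norm_bounded (hs2.hasSum.mul_left _) (Npairs_bound q hq a b Y hY)

open Classical in
theorem family_count (q : ℕ) (a b : ℤ) (Y : ℝ) (hY : 1 ≤ Y) :
    |(({AB ∈ curveFamily (Y ^ 2) | AB.1 ≡ a [ZMOD (q : ℤ)] ∧ AB.2 ≡ b [ZMOD (q : ℤ)]}).ncard : ℝ)
      - #{AB ∈ boxPairs q a b Y | MinPair AB}| ≤ 3 * Y ^ 2 := by
  set I := Icc (-⌊Y ^ 2⌋) ⌊Y ^ 2⌋ with hI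
  set J := Icc (-⌊Y⌋) ⌊Y⌋ with hJ
  set T : Finset (ℤ × ℤ) := {AB ∈ I ×ˢ J | (AB.1 ^ 2 - 4 * AB.2 ≠ 0 ∧ MinPair AB) ∧
    AB.1 ≡ a [ZMOD (q : ℤ)] ∧ AB.2 ≡ b [ZMOD (q : ℤ)]} with hT
  have hA : ∀ x : ℤ, (|x| : ℝ) ≤ Y ^ 2 ↔ x ∈ I := by
    intro x
    rw [hI, mem_Icc, ← abs_le, Int.le_floor]
    push_cast; rfl
  have hB : ∀ x : ℤ, (x : ℝ) ^ 2 ≤ Y ^ 2 ↔ x ∈ J := by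
    intro x
    rw [hJ, mem_Icc, ← abs_le, Int.le_floor, sq_le_sq, abs_of_nonneg (by linarith : 0 ≤ Y)]
    push_cast; rfl
  have hset : {AB ∈ curveFamily (Y ^ 2) | AB.1 ≡ a [ZMOD (q : ℤ)] ∧ AB.2 ≡ b [ZMOD (q : ℤ)]}
      = (T : Set (ℤ × ℤ)) := by
    ext AB
    rw [hT, Finset.mem_coe, mem_filter, mem_product, ← hA, ← hB]
    simp only [curveFamily, Set.mem_ofPred_eq, MinPair]
    tauto
  rw [hset, Set.ncard_coe_finset]
  set T' := {AB ∈ boxPairs q a b Y | MinPair AB} with hT'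
  have hT'mem : ∀ AB, AB ∈ T' ↔ (AB.1 ∈ I ∧ AB.2 ≠ 0 ∧ AB.2 ∈ J) ∧
      (AB.1 ≡ a [ZMOD (q : ℤ)] ∧ AB.2 ≡ b [ZMOD (q : ℤ)]) ∧ MinPair AB := by
    intro AB
    rw [hT', mem_filter, boxPairs, mem_filter, mem_product, mem_erase]
    tauto
  have hTmem : ∀ AB, AB ∈ T ↔ (AB.1 ∈ I ∧ AB.2 ∈ J) ∧ (AB.1 ^ 2 - 4 * AB.2 ≠ 0 ∧ MinPair AB) ∧
    AB.1 ≡ a [ZMOD (q : ℤ)] ∧ AB.2 ≡ b [ZMOD (q : ℤ)] := by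
    intro AB
    rw [hT, mem_filter, mem_product]
  have hIc : (#I : ℝ) ≤ 3 * Y ^ 2 := by
    have h0 : 0 ≤ ⌊Y ^ 2⌋ := Int.floor_nonneg.2 (by positivity)
    have h1 : (#I : ℤ) = 2 * ⌊Y ^ 2⌋ + 1 := by
      rw [hI, Int.card_Icc]; omega
    have h2 : (#I : ℝ) = 2 * ⌊Y ^ 2⌋ + 1 := by exact_mod_cast h1
    have h3 := Int.floor_le (Y ^ 2)
    nlinarith
  have hsub1 : T ⊆ T' ∪ I.image (fun x => (x, (0 : ℤ))) := by
    intro AB h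
    rw [hTmem] at h
    rw [mem_union, hT'mem, mem_image]
    by_cases h0 : AB.2 = 0
    · right; exact ⟨AB.1, h.1.1, by rw [← h0]⟩
    · left; tauto
  have hsub2 : T' ⊆ T ∪ I.image (fun x => (x, x ^ 2 / 4)) := by
    intro AB h
    rw [hT'mem] at h
    rw [mem_union, hTmem, mem_image]
    by_cases h0 : AB.1 ^ 2 - 4 * AB.2 = 0
    · right
      refine ⟨AB.1, h.1.1, ?_⟩
      have : AB.1 ^ 2 / 4 = AB.2 := by omega
      rw [this]
    · left; tauto
  have c1 : #T ≤ #T' + #I :=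
    (card_le_card hsub1).trans ((card_union_le _ _).trans (by gcongr; exact card_image_le))
  have c2 : #T' ≤ #T + #I :=
    (card_le_card hsub2).trans ((card_union_le _ _).trans (by gcongr; exact card_image_le))
  have c1' : (#T : ℝ) ≤ #T' + #I := by exact_mod_cast c1
  have c2' : (#T' : ℝ) ≤ #T + #I := by exact_mod_cast c2
  rw [abs_le]; constructor <;> linarith

end

/-- For squarefree `q` and a residue pair `(a,b)` mod `q`,
`#{(A,B) ∈ 𝓔(X) : (A,B) ≡ (a,b) (mod q)} = δ(q;(a,b)) · 4X^{3/2}/ζ(6) + O(q²X + q⁶X^{3/8})`,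
with an absolute implied constant. -/
theorem count_congruence_classes :
    ∃ C : ℝ, 0 < C ∧ ∀ q : ℕ, Squarefree q → ∀ a b : ℤ, ∀ X : ℝ, 1 ≤ X →
      |(({AB ∈ curveFamily X | AB.1 ≡ a [ZMOD (q : ℤ)] ∧ AB.2 ≡ b [ZMOD (q : ℤ)]}).ncard : ℝ)
          - localDensity q a b * (4 * X ^ ((3 : ℝ) / 2) / zetaSix)|
        ≤ C * ((q : ℝ) ^ 2 * X + (q : ℝ) ^ 6 * X ^ ((3 : ℝ) / 8)) := by
  have hK : 0 ≤ ∑' d : ℕ, 1 / (d : ℝ) ^ 2 := tsum_nonneg fun d => by positivity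
  refine ⟨3 + 16 * ∑' d : ℕ, 1 / (d : ℝ) ^ 2, by linarith, ?_⟩
  intro q hq a b X hX
  obtain ⟨Y, hY, rfl⟩ : ∃ Y : ℝ, 1 ≤ Y ∧ X = Y ^ 2 :=
    ⟨Real.sqrt X, by rwa [Real.one_le_sqrt], (Real.sq_sqrt (by linarith)).symm⟩
  have e : (Y ^ 2) ^ ((3 : ℝ) / 2) = Y ^ 3 := by
    rw [← Real.rpow_natCast Y 2, ← Real.rpow_mul (by linarith), ← Real.rpow_natCast Y 3]
    norm_num
  rw [e]
  have h1 := box_asymp q hq a b Y hY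
  have h2 := family_count q a b Y hY
  have h3 := abs_add_le _ _ |>.trans (add_le_add h2 h1)
  rw [sub_add_sub_cancel] at h3
  have hqR : (1 : ℝ) ≤ q := by exact_mod_cast Nat.pos_of_ne_zero hq.ne_zero
  have hq2 : (1 : ℝ) ≤ (q : ℝ) ^ 2 := one_le_pow₀ hqR
  have h4 : Y ^ 2 ≤ (q : ℝ) ^ 2 * Y ^ 2 + (q : ℝ) ^ 6 * (Y ^ 2) ^ ((3 : ℝ) / 8) := by
    have : 0 ≤ (q : ℝ) ^ 6 * (Y ^ 2) ^ ((3 : ℝ) / 8) := by positivity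
    have : 1 * Y ^ 2 ≤ (q : ℝ) ^ 2 * Y ^ 2 := by gcongr
    linarith
  calc _ ≤ _ := h3
    _ = (3 + 16 * ∑' d : ℕ, 1 / (d : ℝ) ^ 2) * Y ^ 2 := by ring
    _ ≤ _ := by gcongr
end
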